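/- Let X₁, X₂ be compact Hausdorff spaces and suppose T : C(X₁; ℂ) → C(X₂; ℂ) is a surjective linear isometry. Then there exist a homeomorphism τ : X₂ → X₁ and a continuous function φ : X₂ → ℂ with |φ(x)| = 1 for all x ∈ X₂, such that (Tf)(x) = φ(x) · f(τ(x)) for all f ∈ C(X₁; ℂ) and all x ∈ X₂. -/

import Mathlib

namespace BanachStone

variable {X Y : Type*} [TopologicalSpace X] [CompactSpace X] [TopologicalSpace Y] [CompactSpace Y]

/-- A nonzero continuous function on a compact space attains its norm. -/
theorem exists_norm_apply_eq_norm {f : C(X, ℂ)} (hf : 0 < ‖f‖) : ∃ x, ‖f x‖ = ‖f‖ := by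
  by_contra! h
  exact lt_irrefl _ ((f.norm_lt_iff hf).2 fun x => (f.norm_coe_le_norm x).lt_of_ne (h x))

/-- The functions in the unit ball of `C(X, ℂ)` taking the value `1` at `p`. -/
def peakSet (p : X) : Set C(X, ℂ) := {f | f p = 1 ∧ ‖f‖ ≤ 1}

theorem norm_eq_one_of_mem_peakSet {p : X} {f : C(X, ℂ)} (hf : f ∈ peakSet p) : ‖f‖ = 1 := by
  refine le_antisymm hf.2 ?_
  simpa [hf.1] using f.norm_coe_le_norm p

theorem one_mem_peakSet (p : X) : (1 : C(X, ℂ)) ∈ peakSet p :=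
  ⟨rfl, (ContinuousMap.norm_le _ zero_le_one).2 fun _ => by simp⟩

theorem half_smul_add_mem_peakSet {p : X} {f g : C(X, ℂ)} (hf : f ∈ peakSet p)
    (hg : g ∈ peakSet p) : (2⁻¹ : ℂ) • (f + g) ∈ peakSet p := by
  refine ⟨by simp [hf.1, hg.1]; norm_num, ?_⟩
  rw [norm_smul, norm_inv, Complex.norm_two]
  linarith [norm_add_le f g, hf.2, hg.2]

theorem norm_apply_le_one_of_mem_peakSet (T : C(X, ℂ) →ₗᵢ[ℂ] C(Y, ℂ)) {p : X} {f : C(X, ℂ)}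
    (hf : f ∈ peakSet p) (q : Y) : ‖T f q‖ ≤ 1 :=
  ((T f).norm_coe_le_norm q).trans (by rw [T.norm_map]; exact hf.2)

theorem norm_apply_eq_one_of_norm_apply_half_smul_add (T : C(X, ℂ) →ₗᵢ[ℂ] C(Y, ℂ)) {p : X}
    {f g : C(X, ℂ)} (hf : f ∈ peakSet p) (hg : g ∈ peakSet p) {q : Y}
    (h : ‖T ((2⁻¹ : ℂ) • (f + g)) q‖ = 1) :
    ‖T f q‖ = 1 ∧ ‖T g q‖ = 1 ∧ T f q = T g q := by
  have hf' := norm_apply_le_one_of_mem_peakSet T hf q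
  have hg' := norm_apply_le_one_of_mem_peakSet T hg q
  have hsum : ‖T f q + T g q‖ = 2 := by
    rw [map_smul, map_add, ContinuousMap.smul_apply, ContinuousMap.add_apply, norm_smul,
      norm_inv, Complex.norm_two] at h
    linarith
  have htri := norm_add_le (T f q) (T g q)
  have hf1 : ‖T f q‖ = 1 := by linarith
  have hg1 : ‖T g q‖ = 1 := by linarith
  exact ⟨hf1, hg1, eq_of_norm_eq_of_norm_add_eq (by rw [hf1, hg1]) (by linarith)⟩

/-- The images of the functions peaking at `p` have a common peak point, at which they agree. -/
theorem exists_forall_mem_peakSet_apply_eq (T : C(X, ℂ) →ₗᵢ[ℂ] C(Y, ℂ)) (p : X) :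
    ∃ q : Y, ‖T 1 q‖ = 1 ∧ ∀ f ∈ peakSet p, T f q = T 1 q := by
  let K : peakSet p → Set Y := fun f => {q | ‖T f q‖ = 1}
  have hclosed : ∀ f, IsClosed (K f) := fun f =>
    isClosed_eq (T f).continuous.norm continuous_const
  have hne : ∀ f, (K f).Nonempty := by
    intro f
    have h1 : ‖T f‖ = 1 := by rw [T.norm_map, norm_eq_one_of_mem_peakSet f.2]
    obtain ⟨q, hq⟩ := exists_norm_apply_eq_norm (h1 ▸ one_pos)
    exact ⟨q, hq.trans h1⟩
  have hdir : Directed (· ⊇ ·) K := fun f g =>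
    ⟨⟨_, half_smul_add_mem_peakSet f.2 g.2⟩,
      fun _ hq => (norm_apply_eq_one_of_norm_apply_half_smul_add T f.2 g.2 hq).1,
      fun _ hq => (norm_apply_eq_one_of_norm_apply_half_smul_add T f.2 g.2 hq).2.1⟩
  have : Nonempty (peakSet p) := ⟨⟨1, one_mem_peakSet p⟩⟩
  obtain ⟨q, hq⟩ := IsCompact.nonempty_iInter_of_directed_nonempty_isCompact_isClosed K hdir hne
    (fun f => (hclosed f).isCompact) hclosed
  rw [Set.mem_iInter] at hq
  exact ⟨q, hq ⟨1, one_mem_peakSet p⟩, fun f hf =>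
    (norm_apply_eq_one_of_norm_apply_half_smul_add T hf (one_mem_peakSet p)
      (hq ⟨_, half_smul_add_mem_peakSet hf (one_mem_peakSet p)⟩)).2.2⟩

/-- A function in the unit ball vanishing at `p` is a difference of two functions peaking at `p`,
namely of `1 - |f| + f` and `1 - |f|`. -/
theorem exists_mem_peakSet_add_mem_peakSet {p : X} {f : C(X, ℂ)} (hp : f p = 0) (hf : ‖f‖ ≤ 1) :
    ∃ g ∈ peakSet p, g + f ∈ peakSet p := by
  let g : C(X, ℂ) := ⟨fun x => ((1 - ‖f x‖ : ℝ) : ℂ), by fun_prop⟩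
  have hg : ∀ x, ‖g x‖ = 1 - ‖f x‖ := fun x =>
    Complex.norm_of_nonneg (sub_nonneg.2 ((f.norm_coe_le_norm x).trans hf))
  have hgp : g p = 1 := by simp [g, hp]
  refine ⟨g, ⟨hgp, ?_⟩, by simp [hgp, hp], ?_⟩
  · refine (ContinuousMap.norm_le _ zero_le_one).2 fun x => ?_
    linarith [hg x, norm_nonneg (f x)]
  · refine (ContinuousMap.norm_le _ zero_le_one).2 fun x => ?_
    exact (norm_add_le (g x) (f x)).trans (by rw [hg]; linarith)

/-- For a linear isometry `T`, every evaluation at a point `p` is, up to the unimodular factor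
`T 1 q`, the composition of `T` with the evaluation at some point `q`. -/
theorem exists_forall_apply_eq_mul (T : C(X, ℂ) →ₗᵢ[ℂ] C(Y, ℂ)) (p : X) :
    ∃ q : Y, ‖T 1 q‖ = 1 ∧ ∀ f, T f q = T 1 q * f p := by
  obtain ⟨q, hq1, hq⟩ := exists_forall_mem_peakSet_apply_eq T p
  have hball : ∀ f : C(X, ℂ), f p = 0 → ‖f‖ ≤ 1 → T f q = 0 := by
    intro f hp hf
    obtain ⟨g, hg, hgf⟩ := exists_mem_peakSet_add_mem_peakSet hp hf
    have h := hq _ hgf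
    rwa [map_add, ContinuousMap.add_apply, hq g hg, add_eq_left] at h
  have hzero : ∀ f : C(X, ℂ), f p = 0 → T f q = 0 := by
    intro f hp
    rcases eq_or_ne f 0 with rfl | hf
    · simp
    have h := hball (((‖f‖ : ℂ)⁻¹) • f) (by simp [hp])
      (by rw [norm_smul, norm_inv, Complex.norm_real, norm_norm,
        inv_mul_cancel₀ (norm_ne_zero_iff.2 hf)])
    simpa [hf] using h
  refine ⟨q, hq1, fun f => ?_⟩
  have h := hzero (f - f p • 1) (by simp)
  rw [map_sub, map_smul, ContinuousMap.sub_apply, ContinuousMap.smul_apply, smul_eq_mul,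
    sub_eq_zero] at h
  rw [h, mul_comm]

/-- Continuous complex functions separate points from closed sets of a compact Hausdorff space. -/
theorem exists_apply_eq_zero_eqOn_one [T2Space X] {p : X} {K : Set X} (hK : IsClosed K)
    (hp : p ∉ K) : ∃ f : C(X, ℂ), f p = 0 ∧ Set.EqOn f 1 K := by
  obtain ⟨f, hf, hfp, hfK⟩ := CompletelyRegularSpace.completely_regular p K hK hp
  exact ⟨⟨fun x => ((f x : ℝ) : ℂ), by fun_prop⟩, by simp [hfp], fun x hx => by simp [hfK hx]⟩

theorem eq_of_forall_apply_eq [T2Space X] {p q : X} (h : ∀ f : C(X, ℂ), f p = f q) : p = q := by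
  by_contra hne
  obtain ⟨f, hfp, hfq⟩ := exists_apply_eq_zero_eqOn_one (isClosed_singleton (x := q)) hne
  have := hfq rfl
  rw [← h f, hfp] at this
  exact zero_ne_one this

theorem continuous_of_forall_continuous_comp {Z : Type*} [TopologicalSpace Z] [T2Space X]
    {τ : Z → X} (h : ∀ f : C(X, ℂ), Continuous fun z => f (τ z)) : Continuous τ := by
  refine continuous_iff_continuousAt.2 fun y s hs => ?_
  obtain ⟨f, hfy, hf⟩ := exists_apply_eq_zero_eqOn_one (isOpen_interior (s := s)).isClosed_compl
    (not_not.2 (mem_interior_iff_mem_nhds.2 hs))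
  rw [Filter.mem_map]
  filter_upwards [(h f).continuousAt.eventually_ne (hfy.trans_ne zero_ne_one)] with z hz
  by_contra hzs
  exact hz (hf fun hmem => hzs (interior_subset (s := s) hmem))

end BanachStone

theorem banach_stone_complex
    {X₁ X₂ : Type*} [TopologicalSpace X₁] [CompactSpace X₁] [T2Space X₁]
    [TopologicalSpace X₂] [CompactSpace X₂] [T2Space X₂]
    (T : C(X₁, ℂ) →L[ℂ] C(X₂, ℂ)) (hT : ∀ f : C(X₁, ℂ), ‖T f‖ = ‖f‖)
    (hsurj : Function.Surjective T) :
    ∃ (τ : X₂ ≃ₜ X₁) (φ : C(X₂, ℂ)),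
      (∀ x : X₂, ‖φ x‖ = 1) ∧
      ∀ (f : C(X₁, ℂ)) (x : X₂), (T f) x = φ x * f (τ x) := by
  let U : C(X₁, ℂ) ≃ₗᵢ[ℂ] C(X₂, ℂ) := .ofSurjective ⟨T.toLinearMap, hT⟩ hsurj
  have hU : ∀ f, U f = T f := fun _ => rfl
  have hpoint : ∀ x : X₂, ∃ y : X₁, ‖T 1 x‖ = 1 ∧ ∀ f, T f x = T 1 x * f y := by
    intro x
    obtain ⟨y, hy1, hy⟩ := BanachStone.exists_forall_apply_eq_mul U.symm.toLinearIsometry x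
    set c := U.symm.toLinearIsometry 1 y
    have hy' : ∀ f : C(X₁, ℂ), f y = c * T f x := fun f => by
      have h := hy (U f)
      rwa [LinearIsometryEquiv.coe_toLinearIsometry, U.symm_apply_apply, hU] at h
    have hone : c * T 1 x = 1 := (hy' 1).symm
    refine ⟨y, by simpa [hy1] using congrArg norm hone, fun f => ?_⟩
    rw [hy' f]
    linear_combination (-T f x) * hone
  choose τ hnorm hτ using hpoint
  have hne : ∀ x, T 1 x ≠ 0 := fun x h => by simpa [h] using hnorm x
  have hcont : Continuous τ := BanachStone.continuous_of_forall_continuous_comp fun f =>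
    ((T f).continuous.div (T 1).continuous hne).congr fun x => by
      rw [Pi.div_apply, hτ x f, mul_div_cancel_left₀ _ (hne x)]
  have hinj : Function.Injective τ := fun x x' h => by
    obtain ⟨f, hf⟩ := hsurj 1
    have hinv : ∀ z, T 1 z * f (τ z) = 1 := fun z => by rw [← hτ, hf]; rfl
    have hφ : T 1 x = T 1 x' := by
      apply mul_right_cancel₀ (b := f (τ x)) (right_ne_zero_of_mul_eq_one (hinv x))
      rw [hinv x, h, hinv x']
    refine BanachStone.eq_of_forall_apply_eq fun g => ?_
    obtain ⟨f, rfl⟩ := hsurj g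
    rw [hτ x, hτ x', h, hφ]
  have hsurj_τ : Function.Surjective τ := fun y => by
    obtain ⟨x, -, hx⟩ := BanachStone.exists_forall_apply_eq_mul U.toLinearIsometry y
    refine ⟨x, BanachStone.eq_of_forall_apply_eq fun f => ?_⟩
    exact mul_left_cancel₀ (hne x) ((hτ x f).symm.trans (hx f))
  exact ⟨Continuous.homeoOfEquivCompactToT2 (f := .ofBijective τ ⟨hinj, hsurj_τ⟩) hcont, T 1, hnorm,
    fun f x => hτ x f⟩
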